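/- The Martin boundary of a projective limit of simplices contains the closure of its Choquet boundary: for every point x in the closure (in Σ∞) of the set of extreme points of Σ∞, there exists a sequence of vertices α : (n : ℕ) → V n such that for every m : ℕ, the points π[n,m] (e (α n)) converge in stdSimplex ℝ (V m), as n → ∞, to x m. -/

import Mathlib

open scoped BigOperators
open Filter Topology

/-- The one-step affine projection induced by the cotransition probabilities `lam`:
`(π n x) u = ∑ v, lam n v u * x v`. -/
def projStep (V : ℕ → Type) [∀ n, Fintype (V n)]
    (lam : ∀ n, V (n + 1) → V n → ℝ) (n : ℕ) (x : V (n + 1) → ℝ) : V n → ℝ :=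
  fun u => ∑ v, lam n v u * x v

/-- The iterated projection `π[n,m] = π m ∘ ⋯ ∘ π (n-1)` for `m ≤ n` (with `π[n,n] = id`). -/
def projIter (V : ℕ → Type) [∀ n, Fintype (V n)]
    (lam : ∀ n, V (n + 1) → V n → ℝ) {m n : ℕ} (h : m ≤ n) :
    (V n → ℝ) → V m → ℝ :=
  Nat.leRecOn (C := fun k => (V k → ℝ) → V m → ℝ) h
    (fun {k} f x => f (projStep V lam k x)) id

/-- The projective limit `Σ∞`. -/
def SigmaInf (V : ℕ → Type) [∀ n, Fintype (V n)]
    (lam : ∀ n, V (n + 1) → V n → ℝ) : Set (∀ n, V n → ℝ) :=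
  {x | (∀ n, x n ∈ stdSimplex ℝ (V n)) ∧ ∀ n, projStep V lam n (x (n + 1)) = x n}

/-- The vertex `e v` of the simplex `stdSimplex ℝ (V n)`: the indicator function of `v`. -/
def vert (V : ℕ → Type) [∀ n, DecidableEq (V n)] {n : ℕ} (v : V n) : V n → ℝ :=
  fun u => if u = v then 1 else 0

/-- Extremality: a consistent family squeezed between `0` and an extreme `y` is proportional. -/
lemma extreme_prop (V : ℕ → Type) [∀ n, Fintype (V n)]
    (lam : ∀ n, V (n + 1) → V n → ℝ)
    (y : ∀ n, V n → ℝ) (hy : y ∈ Set.extremePoints ℝ (SigmaInf V lam))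
    (z : ∀ n, V n → ℝ) (c : ℝ) (hc0 : 0 ≤ c) (hc1 : c ≤ 1)
    (hz0 : ∀ n u, 0 ≤ z n u) (hzy : ∀ n u, z n u ≤ y n u)
    (hzs : ∀ n, ∑ u, z n u = c)
    (hzc : ∀ n u, ∑ v, lam n v u * z (n + 1) v = z n u) :
    ∀ n u, z n u = c * y n u := by
  obtain ⟨⟨hyS, hyc⟩, hext⟩ := hy
  have hyc' : ∀ n u, ∑ v, lam n v u * y (n + 1) v = y n u := fun n u => congrFun (hyc n) u
  have h1 : (fun n u => y n u + (z n u - c * y n u)) ∈ SigmaInf V lam := by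
    refine ⟨fun n => ⟨fun u => ?_, ?_⟩, fun n => ?_⟩
    · have := mul_le_mul_of_nonneg_right hc1 ((hyS n).1 u)
      have := hz0 n u
      linarith
    · rw [Finset.sum_add_distrib, Finset.sum_sub_distrib, ← Finset.mul_sum, hzs, (hyS n).2]
      ring
    · funext u
      simp only [projStep]
      rw [← hyc' n u, ← hzc n u, Finset.mul_sum, ← Finset.sum_sub_distrib,
        ← Finset.sum_add_distrib]
      exact Finset.sum_congr rfl fun v _ => by ring
  have h2 : (fun n u => y n u - (z n u - c * y n u)) ∈ SigmaInf V lam := by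
    refine ⟨fun n => ⟨fun u => ?_, ?_⟩, fun n => ?_⟩
    · have := mul_nonneg hc0 ((hyS n).1 u)
      have := hzy n u
      linarith
    · rw [Finset.sum_sub_distrib, Finset.sum_sub_distrib, ← Finset.mul_sum, hzs, (hyS n).2]
      ring
    · funext u
      simp only [projStep]
      rw [← hyc' n u, ← hzc n u, Finset.mul_sum, ← Finset.sum_sub_distrib,
        ← Finset.sum_sub_distrib]
      exact Finset.sum_congr rfl fun v _ => by ring
  have h3 : y ∈ openSegment ℝ (fun n u => y n u + (z n u - c * y n u))
      (fun n u => y n u - (z n u - c * y n u)) := by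
    refine ⟨1/2, 1/2, by norm_num, by norm_num, by norm_num, ?_⟩
    funext n u
    simp only [Pi.add_apply, Pi.smul_apply, smul_eq_mul]
    ring
  have h4 := hext h1 h2 h3
  intro n u
  have := congrFun (congrFun h4 n) u
  linarith

lemma extreme_lim (V : ℕ → Type) [∀ n, Fintype (V n)]
    (lam : ∀ n, V (n + 1) → V n → ℝ)
    (K : ∀ n m, V n → V m → ℝ)
    (K0 : ∀ n m v u, 0 ≤ K n m v u)
    (K1 : ∀ n m v, m ≤ n → ∑ u, K n m v u = 1)
    (Kle : ∀ n m v u, K n m v u ≤ 1)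
    (Kc : ∀ n m v u, m + 1 ≤ n → ∑ w, lam m w u * K n (m + 1) v w = K n m v u)
    (y : ∀ n, V n → ℝ) (hy : y ∈ Set.extremePoints ℝ (SigmaInf V lam))
    (Ky : ∀ n m u, m ≤ n → ∑ v, y n v * K n m v u = y m u)
    (Ky' : ∀ n m u, ∑ v, y n v * K n m v u ≤ y m u)
    (m₀ : ℕ) (u₀ : V m₀) :
    Tendsto (fun n => ∑ v, y n v * (K n m₀ v u₀ * K n m₀ v u₀)) atTop
      (𝓝 (y m₀ u₀ * y m₀ u₀)) := by
  rw [tendsto_iff_ultrafilter]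
  intro g hg
  have y0 : ∀ n u, 0 ≤ y n u := fun n u => (hy.1.1 n).1 u
  have y1 : ∀ n, ∑ u, y n u = 1 := fun n => (hy.1.1 n).2
  have hge : ∀ k : ℕ, ∀ᶠ n in (g : Filter ℕ), k ≤ n := fun k => hg (eventually_ge_atTop k)
  let Z : ∀ n m, V m → ℝ := fun n m u => ∑ v, y n v * (K n m₀ v u₀ * K n m v u)
  have Z0 : ∀ n m u, 0 ≤ Z n m u := fun n m u =>
    Finset.sum_nonneg fun v _ => mul_nonneg (y0 _ _) (mul_nonneg (K0 _ _ _ _) (K0 _ _ _ _))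
  have Zy : ∀ n m u, Z n m u ≤ y m u := fun n m u => by
    refine le_trans (Finset.sum_le_sum fun v _ => ?_) (Ky' n m u)
    refine mul_le_mul_of_nonneg_left ?_ (y0 _ _)
    exact mul_le_of_le_one_left (K0 _ _ _ _) (Kle _ _ _ _)
  have hex : ∀ m (u : V m), ∃ a, Tendsto (fun n => Z n m u) g (𝓝 a) := by
    intro m u
    obtain ⟨a, -, ha⟩ := (isCompact_Icc (a := (0:ℝ)) (b := y m u)).ultrafilter_le_nhds
      (g.map (fun n => Z n m u)) (by
        rw [le_principal_iff]
        exact Filter.mem_map.2 (Filter.univ_mem' fun n => ⟨Z0 n m u, Zy n m u⟩))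
    exact ⟨a, ha⟩
  choose z hz using hex
  have key := extreme_prop V lam y hy z (y m₀ u₀) (y0 _ _)
    (by rw [← y1 m₀]; exact Finset.single_le_sum (fun i _ => y0 m₀ i) (Finset.mem_univ u₀))
    (fun n u => ge_of_tendsto' (hz n u) fun k => Z0 k n u)
    (fun n u => le_of_tendsto' (hz n u) fun k => Zy k n u)
    (fun m => by
      refine tendsto_nhds_unique (tendsto_finsetSum _ fun u _ => hz m u) ?_
      refine tendsto_const_nhds.congr' ?_
      filter_upwards [hge m, hge m₀] with n h1 h2
      simp only [Z]
      rw [Finset.sum_comm, ← Ky n m₀ u₀ h2]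
      refine Finset.sum_congr rfl fun v _ => ?_
      rw [← Finset.mul_sum, ← Finset.mul_sum, K1 n m v h1, mul_one])
    (fun m u => by
      refine tendsto_nhds_unique
        (tendsto_finsetSum _ fun w _ => (hz (m+1) w).const_mul (lam m w u)) ?_
      refine (hz m u).congr' ?_
      filter_upwards [hge (m+1)] with n h1
      simp only [Z, Finset.mul_sum]
      rw [Finset.sum_comm]
      refine Finset.sum_congr rfl fun v _ => ?_
      rw [← Kc n m v u h1, Finset.mul_sum, Finset.mul_sum]
      exact Finset.sum_congr rfl fun w _ => by ring)
  rw [← key m₀ u₀]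
  exact hz m₀ u₀

lemma projIter_self (V : ℕ → Type) [∀ n, Fintype (V n)]
    (lam : ∀ n, V (n + 1) → V n → ℝ) {n : ℕ} (h : n ≤ n) (w : V n → ℝ) :
    projIter V lam h w = w := by
  unfold projIter
  rw [Nat.leRecOn_self]; rfl

lemma projIter_succ (V : ℕ → Type) [∀ n, Fintype (V n)]
    (lam : ∀ n, V (n + 1) → V n → ℝ) {m n : ℕ} (h : m ≤ n) (h' : m ≤ n + 1)
    (w : V (n + 1) → ℝ) :
    projIter V lam h' w = projIter V lam h (projStep V lam n w) := by
  unfold projIter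
  rw [Nat.leRecOn_succ h]

lemma projIter_step (V : ℕ → Type) [∀ n, Fintype (V n)]
    (lam : ∀ n, V (n + 1) → V n → ℝ) {m n : ℕ} (h : m + 1 ≤ n) (h' : m ≤ n)
    (w : V n → ℝ) :
    projStep V lam m (projIter V lam h w) = projIter V lam h' w := by
  induction n, h using Nat.le_induction with
  | base =>
    rw [projIter_self, projIter_succ V lam le_rfl, projIter_self]
  | succ n hn ih =>
    rw [projIter_succ V lam hn, projIter_succ V lam (by omega : m ≤ n)]
    exact ih _ _

lemma projIter_mem (V : ℕ → Type) [∀ n, Fintype (V n)]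
    (lam : ∀ n, V (n + 1) → V n → ℝ)
    (hpos : ∀ n (v : V (n + 1)) (u : V n), 0 ≤ lam n v u)
    (hsum : ∀ n (v : V (n + 1)), ∑ u, lam n v u = 1)
    {m n : ℕ} (h : m ≤ n) (w : V n → ℝ) (hw : w ∈ stdSimplex ℝ (V n)) :
    projIter V lam h w ∈ stdSimplex ℝ (V m) := by
  induction n, h using Nat.le_induction with
  | base => rwa [projIter_self]
  | succ n hn ih =>
    rw [projIter_succ V lam hn]
    refine ih _ ⟨fun u => Finset.sum_nonneg fun v _ => mul_nonneg (hpos _ _ _) (hw.1 v), ?_⟩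
    simp only [projStep]
    rw [Finset.sum_comm, ← hw.2]
    refine Finset.sum_congr rfl fun v _ => ?_
    rw [← Finset.sum_mul, hsum, one_mul]

lemma projIter_inf (V : ℕ → Type) [∀ n, Fintype (V n)]
    (lam : ∀ n, V (n + 1) → V n → ℝ)
    (y : ∀ n, V n → ℝ) (hy : y ∈ SigmaInf V lam) {m n : ℕ} (h : m ≤ n) :
    projIter V lam h (y n) = y m := by
  induction n, h using Nat.le_induction with
  | base => rw [projIter_self]
  | succ n hn ih => rw [projIter_succ V lam hn, hy.2 n, ih]

lemma projIter_lin (V : ℕ → Type) [∀ n, Fintype (V n)] [∀ n, DecidableEq (V n)]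
    (lam : ∀ n, V (n + 1) → V n → ℝ) {m n : ℕ} (h : m ≤ n) (w : V n → ℝ) (u : V m) :
    ∑ v, w v * projIter V lam h (vert V v) u = projIter V lam h w u := by
  have : ∃ A : V n → V m → ℝ, ∀ w u, projIter V lam h w u = ∑ v, w v * A v u := by
    clear w u
    induction n, h using Nat.le_induction with
    | base =>
      refine ⟨fun v u => if u = v then 1 else 0, fun w u => ?_⟩
      simp [projIter_self]
    | succ n hn ih =>
      obtain ⟨A, hA⟩ := ih
      refine ⟨fun v u => ∑ t, lam n v t * A t u, fun w u => ?_⟩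
      rw [projIter_succ V lam hn, hA]
      simp only [projStep, Finset.mul_sum, Finset.sum_mul]
      rw [Finset.sum_comm]
      exact Finset.sum_congr rfl fun v _ => Finset.sum_congr rfl fun t _ => by ring
  obtain ⟨A, hA⟩ := this
  rw [hA w u]
  refine Finset.sum_congr rfl fun v _ => ?_
  rw [hA]
  simp [vert]

/-- Near an extreme point there are vertices at every sufficiently high level. -/
lemma extreme_near
    (V : ℕ → Type) [∀ n, Fintype (V n)] [∀ n, Nonempty (V n)] [∀ n, DecidableEq (V n)]
    (lam : ∀ n, V (n + 1) → V n → ℝ)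
    (hpos : ∀ n (v : V (n + 1)) (u : V n), 0 ≤ lam n v u)
    (hsum : ∀ n (v : V (n + 1)), ∑ u, lam n v u = 1)
    (x y : ∀ n, V n → ℝ) (hy : y ∈ Set.extremePoints ℝ (SigmaInf V lam))
    (U : Set (∀ n, V n → ℝ)) (hU : U ∈ 𝓝 y) :
    ∀ᶠ n in atTop, ∃ v : V n,
      (fun m => if h : m ≤ n then projIter V lam h (vert V v) else x m) ∈ U := by
  have y0 : ∀ n u, 0 ≤ y n u := fun n u => (hy.1.1 n).1 u
  have y1 : ∀ n, ∑ u, y n u = 1 := fun n => (hy.1.1 n).2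
  let K : ∀ n m, V n → V m → ℝ := fun n m v u =>
    if h : m ≤ n then projIter V lam h (vert V v) u else 0
  have hK : ∀ n m (h : m ≤ n) v u, K n m v u = projIter V lam h (vert V v) u :=
    fun n m h v u => dif_pos h
  have hK' : ∀ n m (h : ¬ m ≤ n) v u, K n m v u = 0 := fun n m h v u => dif_neg h
  have hmem : ∀ n m (h : m ≤ n) v, projIter V lam h (vert V v) ∈ stdSimplex ℝ (V m) := by
    intro n m h v
    refine projIter_mem V lam hpos hsum h _ ⟨fun u => ?_, ?_⟩
    · unfold vert; split_ifs <;> norm_num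
    · simp [vert]
  have K0 : ∀ n m v u, 0 ≤ K n m v u := by
    intro n m v u
    by_cases h : m ≤ n
    · rw [hK n m h]; exact (hmem n m h v).1 u
    · rw [hK' n m h]
  have K1 : ∀ n m v, m ≤ n → ∑ u, K n m v u = 1 := by
    intro n m v h
    simp only [hK n m h]
    exact (hmem n m h v).2
  have Kle : ∀ n m v u, K n m v u ≤ 1 := by
    intro n m v u
    by_cases h : m ≤ n
    · rw [← K1 n m v h]
      exact Finset.single_le_sum (fun i _ => K0 n m v i) (Finset.mem_univ u)
    · rw [hK' n m h]; exact zero_le_one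
  have Kc : ∀ n m v u, m + 1 ≤ n → ∑ w, lam m w u * K n (m + 1) v w = K n m v u := by
    intro n m v u h
    have h' : m ≤ n := by omega
    simp only [hK n (m+1) h, hK n m h']
    rw [← projIter_step V lam h h']
    rfl
  have Ky : ∀ n m u, m ≤ n → ∑ v, y n v * K n m v u = y m u := by
    intro n m u h
    simp only [hK n m h]
    rw [projIter_lin, projIter_inf V lam y hy.1]
  have Ky' : ∀ n m u, ∑ v, y n v * K n m v u ≤ y m u := by
    intro n m u
    by_cases h : m ≤ n
    · exact (Ky n m u h).le
    · simp only [hK' n m h, mul_zero, Finset.sum_const_zero]; exact y0 m u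
  have hvar : ∀ m (u : V m), Tendsto (fun n => ∑ v, y n v * (K n m v u - y m u) ^ 2) atTop
      (𝓝 0) := by
    intro m u
    have h1 := extreme_lim V lam K K0 K1 Kle Kc y hy Ky Ky' m u
    have h2 := h1.sub_const (y m u * y m u)
    rw [sub_self] at h2
    refine h2.congr' ?_
    filter_upwards [eventually_ge_atTop m] with n hn
    have e1 : ∑ v, y n v * (K n m v u - y m u) ^ 2 =
        ∑ v, y n v * (K n m v u * K n m v u) - 2 * y m u * ∑ v, y n v * K n m v u
          + y m u ^ 2 * ∑ v, y n v := by
      rw [Finset.mul_sum, Finset.mul_sum, ← Finset.sum_sub_distrib, ← Finset.sum_add_distrib]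
      exact Finset.sum_congr rfl fun v _ => by ring
    rw [e1, Ky n m u hn, y1]
    ring
  rw [nhds_pi, Filter.mem_pi] at hU
  obtain ⟨I, hI, t, ht, htU⟩ := hU
  let F : ∀ n, V n → ℝ := fun n v => ∑ m ∈ hI.toFinset, ∑ u, (K n m v u - y m u) ^ 2
  have F0 : ∀ n v, 0 ≤ F n v := fun n v =>
    Finset.sum_nonneg fun m _ => Finset.sum_nonneg fun u _ => sq_nonneg _
  have hmin : ∀ n, ∃ v : V n, ∀ w, F n v ≤ F n w := fun n => Finite.exists_min (F n)
  choose α hα using hmin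
  have hF : Tendsto (fun n => F n (α n)) atTop (𝓝 0) := by
    have hs : Tendsto (fun n => ∑ m ∈ hI.toFinset, ∑ u : V m,
        ∑ v, y n v * (K n m v u - y m u) ^ 2) atTop (𝓝 0) := by
      have := tendsto_finsetSum (hI.toFinset) fun m _ =>
        tendsto_finsetSum (Finset.univ : Finset (V m)) fun u _ => hvar m u
      simpa using this
    refine squeeze_zero (fun n => F0 n _) (fun n => ?_) hs
    have e : ∑ m ∈ hI.toFinset, ∑ u : V m, ∑ v, y n v * (K n m v u - y m u) ^ 2
        = ∑ v, y n v * F n v := by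
      simp only [F, Finset.mul_sum]
      rw [Finset.sum_comm]
      refine Finset.sum_congr rfl fun m _ => ?_
      rw [Finset.sum_comm]
    rw [e]
    calc F n (α n) = ∑ v, y n v * F n (α n) := by rw [← Finset.sum_mul, y1, one_mul]
      _ ≤ _ := Finset.sum_le_sum fun v _ => mul_le_mul_of_nonneg_left (hα n v) (y0 n v)
  have hm : ∀ m ∈ I, ∀ᶠ n in atTop, K n m (α n) ∈ t m := by
    intro m hmI
    have : Tendsto (fun n => K n m (α n)) atTop (𝓝 (y m)) := by
      rw [tendsto_pi_nhds]
      intro u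
      have hsq : Tendsto (fun n => (K n m (α n) u - y m u) ^ 2) atTop (𝓝 0) := by
        refine squeeze_zero (fun n => sq_nonneg _) (fun n => ?_) hF
        refine le_trans (Finset.single_le_sum
          (f := fun u => (K n m (α n) u - y m u) ^ 2)
          (fun i _ => sq_nonneg _) (Finset.mem_univ u)) ?_
        exact Finset.single_le_sum
          (f := fun m => ∑ u, (K n m (α n) u - y m u) ^ 2)
          (fun i _ => Finset.sum_nonneg fun u _ => sq_nonneg _) (hI.mem_toFinset.2 hmI)
      have h3 := hsq.sqrt
      simp only [Real.sqrt_sq_eq_abs, Real.sqrt_zero] at h3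
      exact tendsto_sub_nhds_zero_iff.1 ((tendsto_zero_iff_abs_tendsto_zero _).2 h3)
    exact this (ht m)
  have hge : ∀ m ∈ I, ∀ᶠ n in atTop, m ≤ n := fun m _ => eventually_ge_atTop m
  filter_upwards [(Filter.eventually_all_finite hI).2 hm,
    (Filter.eventually_all_finite hI).2 hge] with n h1 h2
  refine ⟨α n, htU fun m hmI => ?_⟩
  have h3 := h1 m hmI
  have h4 : K n m (α n) = projIter V lam (h2 m hmI) (vert V (α n)) :=
    funext fun u => hK n m (h2 m hmI) _ u
  rw [h4] at h3
  simpa only [dif_pos (h2 m hmI)] using h3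

/-- the Martin boundary contains the closure of the Choquet boundary: every
point `x ∈ Σ∞` lying in the closure of the set of extreme points of `Σ∞` admits a sequence
of vertices `α n : V n` with `π[n,m] (e (α n)) → x m` as `n → ∞`, for every `m`. -/
theorem martin_boundary_contains_closure_of_choquet
    (V : ℕ → Type) [∀ n, Fintype (V n)] [∀ n, Nonempty (V n)] [∀ n, DecidableEq (V n)]
    (lam : ∀ n, V (n + 1) → V n → ℝ)
    (hpos : ∀ n (v : V (n + 1)) (u : V n), 0 ≤ lam n v u)
    (hsum : ∀ n (v : V (n + 1)), ∑ u, lam n v u = 1)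
    (x : ∀ n, V n → ℝ) (hx : x ∈ SigmaInf V lam)
    (hcl : x ∈ closure (Set.extremePoints ℝ (SigmaInf V lam))) :
    ∃ α : ∀ n, V n, ∀ m : ℕ,
      Tendsto (fun n : ℕ => if h : m ≤ n then projIter V lam h (vert V (α n)) else x m)
        atTop (𝓝 (x m)) := by
  let P : ∀ n, V n → (∀ m, V m → ℝ) := fun n v m =>
    if h : m ≤ n then projIter V lam h (vert V v) else x m
  have hP : ∀ U ∈ 𝓝 x, ∀ᶠ n in atTop, ∃ v : V n, P n v ∈ U := by
    intro U hU
    obtain ⟨W, hWU, hW, hxW⟩ := mem_nhds_iff.1 hU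
    obtain ⟨y, hyW, hy⟩ := mem_closure_iff.1 hcl W hW hxW
    filter_upwards [extreme_near V lam hpos hsum x y hy W (hW.mem_nhds hyW)] with n hn
    exact hn.imp fun v hv => hWU hv
  letI : PseudoMetricSpace (∀ m, V m → ℝ) :=
    TopologicalSpace.pseudoMetrizableSpacePseudoMetric _
  have hmin : ∀ n, ∃ v : V n, ∀ w, dist (P n v) x ≤ dist (P n w) x :=
    fun n => Finite.exists_min fun v => dist (P n v) x
  choose α hα using hmin
  have hlim : Tendsto (fun n => P n (α n)) atTop (𝓝 x) := by
    rw [Metric.tendsto_nhds]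
    intro ε hε
    filter_upwards [hP _ (Metric.ball_mem_nhds x hε)] with n ⟨v, hv⟩
    exact (hα n v).trans_lt hv
  exact ⟨α, fun m => (tendsto_pi_nhds.1 hlim) m⟩
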